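/- Let u ∈ Σ_abs. If ζ, ζ' : [0,∞) → Σ are continuous paths, both satisfying condition (A), with ζ_0 = ζ'_0 = u, then ζ_t = ζ'_t for all t ≥ 0. -/

import Mathlib

open Finset

section ZRP

variable {V : Type*} [Fintype V] [DecidableEq V]

/-- Irreducibility of a set of transition rates. -/
def IrreducibleRates (r : V → V → ℝ) : Prop :=
  ∀ i j : V, i ≠ j → ∃ (m : ℕ) (k : ℕ → V), k 0 = i ∧ k m = j ∧ ∀ l < m, 0 < r (k l) (k (l + 1))

/-- `ind A j` plays the role of the vector `1^A_j`: it equals the indicator of `{j}` on `A`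
and is harmonic (for the generator of `r`) at every point outside `A`. -/
def IsHarmFamily (r : V → V → ℝ) (ind : Finset V → V → V → ℝ) : Prop :=
  ∀ (A : Finset V), ∀ j ∈ A,
    (∀ i ∈ A, ind A j i = if i = j then (1 : ℝ) else 0) ∧
    (∀ k, k ∉ A → ∑ l, r k l * (ind A j l - ind A j k) = 0)

/-- The trace rates `r^A(i,j) = r(i,j) + ∑_{k∉A} r(i,k)·1^A_j(k)` (for `i ≠ j`). -/
noncomputable def traceRate (r : V → V → ℝ) (ind : Finset V → V → V → ℝ)
    (A : Finset V) (i j : V) : ℝ :=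
  if i = j then 0 else r i j + ∑ k ∈ Aᶜ, r i k * ind A j k

/-- `λ^A(i) = ∑_{j∈A} (r^A(j,i) − r^A(i,j))`. -/
noncomputable def lamA (r : V → V → ℝ) (ind : Finset V → V → V → ℝ)
    (A : Finset V) (i : V) : ℝ :=
  ∑ j ∈ A, (traceRate r ind A j i - traceRate r ind A i j)

/-- `A` is `r`-absorbing if `A = V` or `λ^{A∪{j}}(j) ≤ 0` for every `j ∉ A`. -/
def IsAbsorbing (r : V → V → ℝ) (ind : Finset V → V → V → ℝ) (A : Finset V) : Prop :=
  A = Finset.univ ∨ ∀ j ∉ A, lamA r ind (insert j A) j ≤ 0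

/-- The support `𝒮(u) = {i : u i > 0}`. -/
noncomputable def suppF (u : V → ℝ) : Finset V :=
  open scoped Classical in Finset.univ.filter (fun i => 0 < u i)

/-- `𝒜(S)`: the intersection of all `r`-absorbing subsets of `V` containing `S`. -/
noncomputable def minAbs (r : V → V → ℝ) (ind : Finset V → V → V → ℝ) (S : Finset V) :
    Finset V :=
  open scoped Classical in
  Finset.univ.filter (fun i => ∀ A : Finset V, IsAbsorbing r ind A → S ⊆ A → i ∈ A)

/-- The vector `v_i = ∑_k r(i,k)(1_{k} − 1_{i})`. -/
noncomputable def vvec (r : V → V → ℝ) (i : V) : V → ℝ :=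
  fun l => ∑ k, r i k * ((if l = k then (1 : ℝ) else 0) - (if l = i then (1 : ℝ) else 0))

/-- The vector `λ(j) = ∑_i (r(i,j) − r(j,i))`. -/
noncomputable def lamV (r : V → V → ℝ) : V → ℝ := fun j => ∑ i, (r i j - r j i)

/-- Membership in `D_B`: `f` is `C¹` on an open set containing the simplex and
`⟨∇f(u), v_i⟩ = 0` whenever `u ∈ Σ`, `u i = 0`, for every `i ∈ B`. -/
def MemD (r : V → V → ℝ) (B : Finset V) (f : (V → ℝ) → ℝ) : Prop :=
  (∃ U : Set (V → ℝ), IsOpen U ∧ stdSimplex ℝ V ⊆ U ∧ ContDiffOn ℝ 1 f U) ∧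
  ∀ i ∈ B, ∀ u ∈ stdSimplex ℝ V, u i = 0 → fderiv ℝ f u (vvec r i) = 0

/-- Condition (A). -/
def CondA (r : V → V → ℝ) (ζ : ℝ → V → ℝ) : Prop :=
  ∀ f : (V → ℝ) → ℝ, MemD r Finset.univ f → ∀ t : ℝ, 0 ≤ t →
    f (ζ t) = f (ζ 0) + ∫ s in (0:ℝ)..t, fderiv ℝ f (ζ s) (lamV r)

/-- A continuous path in the simplex (for nonnegative times). -/
def IsPath (ζ : ℝ → V → ℝ) : Prop :=
  ContinuousOn ζ (Set.Ici 0) ∧ ∀ t : ℝ, 0 ≤ t → ζ t ∈ stdSimplex ℝ V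

/-- `Σ_abs`: the configurations whose support is `r`-absorbing. -/
def SigmaAbs (r : V → V → ℝ) (ind : Finset V → V → V → ℝ) : Set (V → ℝ) :=
  {u | u ∈ stdSimplex ℝ V ∧ IsAbsorbing r ind (suppF u)}

/-- Condition (B): `inf{t ≥ 0 : ζ_t ∈ Σ_abs} = 0`. -/
def CondB (r : V → V → ℝ) (ind : Finset V → V → V → ℝ) (ζ : ℝ → V → ℝ) : Prop :=
  ∀ ε : ℝ, 0 < ε → ∃ t : ℝ, 0 ≤ t ∧ t < ε ∧ ζ t ∈ SigmaAbs r ind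

end ZRP

section Aux

variable {V : Type*} [Fintype V]

/-- The generator `L w(i) = ∑_k r(i,k) (w(k) − w(i))`. -/
def gen (r : V → V → ℝ) (w : V → ℝ) (i : V) : ℝ := ∑ k, r i k * (w k - w i)

/-- A function that is superharmonic off a nonempty set `A` and nonnegative on `A`
is nonnegative. -/
lemma nonneg_of_superharmonic {r : V → V → ℝ} (hr : ∀ i j, 0 ≤ r i j)
    (hirr : IrreducibleRates r) {A : Finset V} (hA : A.Nonempty) {w : V → ℝ}
    (hwA : ∀ i ∈ A, 0 ≤ w i) (hw : ∀ i ∉ A, gen r w i ≤ 0) (i : V) : 0 ≤ w i := by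
  obtain ⟨a, ha⟩ := hA
  obtain ⟨i₀, -, hmin⟩ := Finset.exists_min_image Finset.univ w ⟨a, Finset.mem_univ a⟩
  by_contra! hi
  have hneg : w i₀ < 0 := (hmin i (Finset.mem_univ _)).trans_lt hi
  have hne : i₀ ≠ a := fun h => absurd (hwA a ha) (by rw [← h]; exact not_le.2 hneg)
  obtain ⟨m, k, hk0, hkm, hk⟩ := hirr i₀ a hne
  have key : ∀ l ≤ m, w (k l) = w i₀ := by
    intro l
    induction l with
    | zero => intro _; rw [hk0]
    | succ l ih =>
      intro hl
      have hkl := ih (by omega)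
      have hnot : k l ∉ A := fun h => absurd (hwA _ h) (by rw [hkl]; exact not_le.2 hneg)
      have hnn : ∀ j ∈ Finset.univ, 0 ≤ r (k l) j * (w j - w (k l)) := fun j _ =>
        mul_nonneg (hr _ _) (by rw [hkl]; linarith [hmin j (Finset.mem_univ _)])
      have hz := (Finset.sum_eq_zero_iff_of_nonneg hnn).1
        (le_antisymm (hw _ hnot) (Finset.sum_nonneg hnn)) (k (l + 1)) (Finset.mem_univ _)
      rcases mul_eq_zero.1 hz with h | h
      · exact absurd h (hk l (by omega)).ne'
      · linarith
  have := key m le_rfl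
  rw [hkm] at this
  linarith [hwA a ha]

lemma gen_sub (r : V → V → ℝ) (w w' : V → ℝ) (i : V) :
    gen r (fun x => w x - w' x) i = gen r w i - gen r w' i := by
  simp only [gen, ← Finset.sum_sub_distrib]
  exact Finset.sum_congr rfl fun k _ => by ring

lemma gen_smul (r : V → V → ℝ) (c : ℝ) (w : V → ℝ) (i : V) :
    gen r (fun x => c * w x) i = c * gen r w i := by
  simp only [gen, Finset.mul_sum]
  exact Finset.sum_congr rfl fun k _ => by ring

lemma gen_sum {ι : Type*} (r : V → V → ℝ) (s : Finset ι) (w : ι → V → ℝ) (i : V) :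
    gen r (fun x => ∑ j ∈ s, w j x) i = ∑ j ∈ s, gen r (w j) i := by
  simp only [gen]
  rw [Finset.sum_comm]
  exact Finset.sum_congr rfl fun k _ => by rw [← Finset.sum_sub_distrib, Finset.mul_sum]

/-- Two functions that agree on a nonempty set `A` and are harmonic off `A` are equal. -/
lemma eq_of_harmonic {r : V → V → ℝ} (hr : ∀ i j, 0 ≤ r i j)
    (hirr : IrreducibleRates r) {A : Finset V} (hA : A.Nonempty) {w w' : V → ℝ}
    (hwA : ∀ i ∈ A, w i = w' i) (hw : ∀ i ∉ A, gen r w i = 0)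
    (hw' : ∀ i ∉ A, gen r w' i = 0) (i : V) : w i = w' i := by
  have h1 := nonneg_of_superharmonic hr hirr hA (w := fun x => w x - w' x)
    (fun i hi => by simp [hwA i hi]) (fun i hi => by rw [gen_sub, hw i hi, hw' i hi, sub_zero]) i
  have h2 := nonneg_of_superharmonic hr hirr hA (w := fun x => w' x - w x)
    (fun i hi => by simp [hwA i hi]) (fun i hi => by rw [gen_sub, hw i hi, hw' i hi, sub_zero]) i
  linarith

variable [DecidableEq V]

lemma sum_mul_vvec (r : V → V → ℝ) (w : V → ℝ) (i : V) :
    ∑ l, w l * vvec r i l = gen r w i := by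
  simp only [vvec, gen, Finset.mul_sum]
  rw [Finset.sum_comm]
  refine Finset.sum_congr rfl fun k _ => ?_
  have : ∀ l, w l * (r i k * ((if l = k then (1 : ℝ) else 0) - if l = i then 1 else 0)) =
      r i k * ((if l = k then w l else 0) - if l = i then w l else 0) := by
    intro l; split_ifs <;> ring
  rw [Finset.sum_congr rfl fun l _ => this l, ← Finset.mul_sum, Finset.sum_sub_distrib]
  simp

omit [DecidableEq V] in
lemma sum_mul_lamV (r : V → V → ℝ) (w : V → ℝ) :
    ∑ l, w l * lamV r l = ∑ i, gen r w i := by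
  have h1 : ∑ l, w l * lamV r l = ∑ l, ∑ i, w l * r i l - ∑ l, ∑ i, w l * r l i := by
    simp only [lamV, Finset.mul_sum, mul_sub, Finset.sum_sub_distrib]
  have h2 : ∑ i, gen r w i = ∑ i, ∑ l, w l * r i l - ∑ l, ∑ i, w l * r l i := by
    simp only [gen, ← Finset.sum_sub_distrib]
    exact Finset.sum_congr rfl fun k _ => Finset.sum_congr rfl fun k _ => by ring
  rw [h1, h2, Finset.sum_comm]

section Harmonic

variable {r : V → V → ℝ} (hr : ∀ i j, 0 ≤ r i j) (hirr : IrreducibleRates r)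
  {ind : Finset V → V → V → ℝ} (hind : IsHarmFamily r ind)
include hind

lemma ind_on {A : Finset V} {i j : V} (hj : j ∈ A) (hi : i ∈ A) :
    ind A j i = if i = j then 1 else 0 := (hind A j hj).1 i hi

lemma gen_ind {A : Finset V} {j k : V} (hj : j ∈ A) (hk : k ∉ A) : gen r (ind A j) k = 0 :=
  (hind A j hj).2 k hk

include hr hirr

lemma ind_nonneg {A : Finset V} {j : V} (hj : j ∈ A) (i : V) : 0 ≤ ind A j i :=
  nonneg_of_superharmonic hr hirr ⟨j, hj⟩
    (fun i hi => by rw [ind_on hind hj hi]; split_ifs <;> norm_num)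
    (fun i hi => (gen_ind hind hj hi).le) i

/-- A function harmonic off `A` is the combination of the `1^A_j` given by its values on `A`. -/
lemma eq_sum_ind {A : Finset V} (hA : A.Nonempty) {w : V → ℝ} (hw : ∀ i ∉ A, gen r w i = 0)
    (i : V) : w i = ∑ j ∈ A, w j * ind A j i := by
  refine eq_of_harmonic hr hirr hA (w' := fun i => ∑ j ∈ A, w j * ind A j i) ?_ hw ?_ i
  · intro i hi
    rw [Finset.sum_eq_single_of_mem i hi]
    · simp [ind_on hind hi hi]
    · intro j hj hji
      simp [ind_on hind hj hi, hji.symm]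
  · intro i hi
    rw [gen_sum]
    exact Finset.sum_eq_zero fun j hj => by rw [gen_smul, gen_ind hind hj hi, mul_zero]

lemma sum_ind {A : Finset V} (hA : A.Nonempty) (i : V) : ∑ j ∈ A, ind A j i = 1 := by
  have := eq_sum_ind hr hirr hind hA (w := fun _ => 1) (fun i _ => by simp [gen]) i
  simpa using this.symm

lemma ind_le_one {A : Finset V} {j : V} (hj : j ∈ A) (i : V) : ind A j i ≤ 1 := by
  rw [← sum_ind hr hirr hind ⟨j, hj⟩ i]
  exact Finset.single_le_sum (f := fun j => ind A j i)
    (fun j hj => ind_nonneg hr hirr hind hj i) hj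

/-- `λ^A(i)` is the pairing of `λ` with `1^A_i`. -/
lemma lamA_eq {A : Finset V} {i : V} (hi : i ∈ A) :
    lamA r ind A i = ∑ l, ind A i l * lamV r l := by
  have hT : ∀ j, ∀ l ∈ A, r j l + ∑ k ∈ Aᶜ, r j k * ind A l k = ∑ k, r j k * ind A l k := by
    intro j l hl
    rw [← Finset.sum_add_sum_compl A, Finset.sum_eq_single_of_mem l hl]
    · simp [ind_on hind hl hl]
    · intro k hk hkl
      simp [ind_on hind hl hk, hkl]
  have h1 : lamA r ind A i =
      ∑ j ∈ A, (∑ k, r j k * ind A i k - ∑ k, r i k * ind A j k) := by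
    refine Finset.sum_congr rfl fun j hj => ?_
    rw [← hT j i hi, ← hT i j hj]
    by_cases hji : j = i
    · subst hji; simp
    · simp [traceRate, hji, Ne.symm hji]
  have h2 : ∑ j ∈ A, ∑ k, r i k * ind A j k = ∑ k, r i k := by
    rw [Finset.sum_comm]
    exact Finset.sum_congr rfl fun k _ => by
      rw [← Finset.mul_sum, sum_ind hr hirr hind ⟨i, hi⟩, mul_one]
  have h3 : ∑ j ∈ A, (∑ k, r j k) * ind A i j = ∑ k, r i k := by
    rw [Finset.sum_eq_single_of_mem i hi]
    · simp [ind_on hind hi hi]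
    · intro k hk hkl
      simp [ind_on hind hi hk, hkl]
  rw [sum_mul_lamV, ← Finset.sum_add_sum_compl A,
    Finset.sum_eq_zero (s := Aᶜ) fun k hk => gen_ind hind hi (Finset.mem_compl.1 hk), add_zero,
    h1, Finset.sum_sub_distrib, h2, ← h3, ← Finset.sum_sub_distrib]
  refine Finset.sum_congr rfl fun j _ => ?_
  rw [gen, Finset.sum_mul, ← Finset.sum_sub_distrib]
  exact Finset.sum_congr rfl fun k _ => by ring

/-- Pairing of `λ` with a function harmonic off `A`. -/
lemma sum_mul_lamV_eq {A : Finset V} (hA : A.Nonempty) {w : V → ℝ}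
    (hw : ∀ i ∉ A, gen r w i = 0) :
    ∑ l, w l * lamV r l = ∑ j ∈ A, w j * lamA r ind A j := by
  have : ∀ l, w l * lamV r l = ∑ j ∈ A, w j * (ind A j l * lamV r l) := by
    intro l
    rw [eq_sum_ind hr hirr hind hA hw l, Finset.sum_mul]
    exact Finset.sum_congr rfl fun j _ => by ring
  simp only [this]
  rw [Finset.sum_comm]
  exact Finset.sum_congr rfl fun j hj => by
    rw [← Finset.mul_sum, lamA_eq hr hirr hind hj]

/-- If `A` is absorbing and `λ^A < 0` on `A ∖ B`, then `B` is absorbing. -/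
lemma IsAbsorbing.of_neg {A B : Finset V} (hA : IsAbsorbing r ind A) (hBA : B ⊆ A)
    (hB : B.Nonempty) (hneg : ∀ i ∈ A, i ∉ B → lamA r ind A i ≤ 0) :
    IsAbsorbing r ind B := by
  have hAne : A.Nonempty := hB.mono hBA
  have hA' : ∀ j ∉ A, lamA r ind (insert j A) j ≤ 0 := by
    rcases hA with h | h
    · intro j hj; simp [h] at hj
    · exact h
  refine Or.inr fun j hjB => ?_
  have hj' : j ∈ insert j B := Finset.mem_insert_self _ _
  have hp0 := ind_nonneg hr hirr hind hj'
  have hp1 := ind_le_one hr hirr hind hj'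
  have hpB : ∀ i ∈ B, ind (insert j B) j i = 0 := fun i hi => by
    rw [ind_on hind hj' (Finset.mem_insert_of_mem hi), if_neg]
    rintro rfl
    exact hjB hi
  rw [lamA_eq hr hirr hind hj']
  by_cases hjA : j ∈ A
  · rw [sum_mul_lamV_eq hr hirr hind hAne fun i hi => gen_ind hind hj' fun h => hi ?_]
    · refine Finset.sum_nonpos fun i hi => ?_
      by_cases hiB : i ∈ B
      · simp [hpB i hiB]
      · exact mul_nonpos_of_nonneg_of_nonpos (hp0 i) (hneg i hi hiB)
    · rcases Finset.mem_insert.1 h with rfl | h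
      exacts [hjA, hBA h]
  · have hjC : j ∈ insert j A := Finset.mem_insert_self _ _
    rw [sum_mul_lamV_eq hr hirr hind ⟨j, hjC⟩ fun i hi => gen_ind hind hj' fun h => hi ?_]
    · rw [Finset.sum_insert hjA, ind_on hind hj' hj', if_pos rfl, one_mul]
      set b := lamA r ind (insert j A) j
      have hb : b ≤ 0 := hA' j hjA
      have hq : ∀ i ∈ A, lamA r ind A i = lamA r ind (insert j A) i + ind A i j * b := by
        intro i hi
        rw [lamA_eq hr hirr hind hi, sum_mul_lamV_eq hr hirr hind ⟨j, hjC⟩ fun k hk =>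
          gen_ind hind hi fun h => hk (Finset.mem_insert_of_mem h), Finset.sum_insert hjA,
          Finset.sum_eq_single_of_mem i hi, ind_on hind hi hi]
        · simp only [if_true]; ring
        · intro k hk hki
          simp [ind_on hind hi hk, hki]
      have hle : ∑ i ∈ A, ind (insert j B) j i * lamA r ind (insert j A) i ≤
          ∑ i ∈ A, ind A i j * (-b) := by
        refine Finset.sum_le_sum fun i hi => ?_
        have hqi := ind_nonneg hr hirr hind hi j
        by_cases hiB : i ∈ B
        · rw [hpB i hiB, zero_mul]
          exact mul_nonneg hqi (by linarith)
        · have h1 : lamA r ind (insert j A) i ≤ ind A i j * (-b) := by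
            linarith [hneg i hi hiB, hq i hi]
          calc _ ≤ ind (insert j B) j i * (ind A i j * (-b)) :=
                mul_le_mul_of_nonneg_left h1 (hp0 i)
            _ ≤ _ := mul_le_of_le_one_left (mul_nonneg hqi (by linarith)) (hp1 i)
      rw [← Finset.sum_mul, sum_ind hr hirr hind hAne] at hle
      linarith
    · rcases Finset.mem_insert.1 h with rfl | h
      exacts [hjC, Finset.mem_insert_of_mem (hBA h)]

end Harmonic

/-- The Green function of the process killed on `A`, with its defining equations in the first and
in the second variable. -/
lemma exists_green {r : V → V → ℝ} (hr : ∀ i j, 0 ≤ r i j) (hirr : IrreducibleRates r)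
    {A : Finset V} (hA : A.Nonempty) : ∃ G : V → V → ℝ,
    (∀ k ∉ A, ∀ x ∈ A, G k x = 0) ∧
    (∀ k ∉ A, ∀ i ∉ A, gen r (G k) i = if i = k then -1 else 0) ∧
    (∀ k ∉ A, ∀ x, (∑ l, r k l) * G k x =
      ∑ l ∈ Aᶜ, r l k * G l x + if x = k then 1 else 0) := by
  let M : Matrix V V ℝ := Matrix.of fun i k =>
    if i ∈ A then (if i = k then 1 else 0) else (if i = k then ∑ l, r i l else 0) - r i k
  have hMA : ∀ w : V → ℝ, ∀ i ∈ A, (M.mulVec w) i = w i := by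
    intro w i hi
    simp [M, Matrix.mulVec, dotProduct, hi]
  have hM : ∀ w : V → ℝ, ∀ i ∉ A, (M.mulVec w) i = - gen r w i := by
    intro w i hi
    simp [M, Matrix.mulVec, dotProduct, hi, gen, sub_mul, mul_sub, Finset.sum_mul]
  have hunit : IsUnit M := by
    rw [← Matrix.mulVec_injective_iff_isUnit]
    intro w w' h
    funext i
    have h' : ∀ i, (M.mulVec w) i = (M.mulVec w') i := fun i => congrFun h i
    have hd : ∀ i, 0 = w i - w' i :=
      eq_of_harmonic (w := fun _ => 0) (w' := fun i => w i - w' i) hr hirr hA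
      (fun i hi => by have := h' i; rw [hMA _ _ hi, hMA _ _ hi] at this; simp [this])
      (fun i _ => by simp [gen])
      (fun i hi => by have := h' i; rw [hM _ _ hi, hM _ _ hi] at this; rw [gen_sub]; linarith)
    linarith [hd i]
  have hdet := (Matrix.isUnit_iff_isUnit_det M).1 hunit
  have hcol : ∀ k i, (M.mulVec fun x => M⁻¹ x k) i = if i = k then 1 else 0 := by
    intro k i
    have := congrFun (congrFun (Matrix.mul_nonsing_inv M hdet) i) k
    rw [Matrix.one_apply] at this
    rw [← this]; rfl
  refine ⟨fun k x => M⁻¹ x k, fun k hk x hx => ?_, fun k hk i hi => ?_, fun k hk x => ?_⟩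
  · have := hcol k x
    rw [hMA _ _ hx, if_neg] at this
    · exact this
    · rintro rfl; exact hk hx
  · have := hcol k i
    rw [hM _ _ hi] at this
    split_ifs at this ⊢ <;> linarith
  · have := congrFun (congrFun (Matrix.nonsing_inv_mul M hdet) x) k
    rw [Matrix.one_apply, Matrix.mul_apply, ← Finset.sum_add_sum_compl A] at this
    have h1 : ∑ l ∈ A, M⁻¹ x l * M l k = 0 := Finset.sum_eq_zero fun l hl => by
      have : l ≠ k := fun h => hk (h ▸ hl)
      simp [M, hl, this]
    have h2 : ∑ l ∈ Aᶜ, M⁻¹ x l * M l k =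
        ∑ l ∈ Aᶜ, (M⁻¹ x l * if l = k then ∑ j, r l j else 0) - ∑ l ∈ Aᶜ, r l k * M⁻¹ x l := by
      rw [← Finset.sum_sub_distrib]
      refine Finset.sum_congr rfl fun l hl => ?_
      simp only [M, Matrix.of_apply, if_neg (Finset.mem_compl.1 hl)]
      ring
    have h3 : ∑ l ∈ Aᶜ, (M⁻¹ x l * if l = k then ∑ j, r l j else 0) =
        M⁻¹ x k * ∑ j, r k j := by
      rw [Finset.sum_eq_single_of_mem k (Finset.mem_compl.2 hk), if_pos rfl]
      intro l _ hl
      simp [hl]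
    simp only
    linarith

lemma deriv_smoothTransition_eq_zero {x : ℝ} (hx : x ≤ 0 ∨ 1 ≤ x) :
    deriv Real.smoothTransition x = 0 := by
  rcases hx with hx | hx
  · refine IsLocalMin.deriv_eq_zero (Filter.Eventually.of_forall fun y => ?_)
    rw [Real.smoothTransition.zero_of_nonpos hx]
    exact Real.smoothTransition.nonneg y
  · refine IsLocalMax.deriv_eq_zero (Filter.Eventually.of_forall fun y => ?_)
    rw [Real.smoothTransition.one_of_one_le hx]
    exact Real.smoothTransition.le_one y

/-- The linear functional `x ↦ ∑ i, w i * x i`. -/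
noncomputable def pairing (w : V → ℝ) : (V → ℝ) →L[ℝ] ℝ :=
  ∑ i, w i • ContinuousLinearMap.proj i

omit [DecidableEq V] in
lemma pairing_apply (w x : V → ℝ) : pairing w x = ∑ i, w i * x i := by
  simp [pairing]

/-- A product of smooth cutoffs of affine functions, times an affine function. -/
noncomputable def cutoffFun (c : V → ℝ) (W : V → V → ℝ) (d : ℝ) (h : V → ℝ) (x : V → ℝ) : ℝ :=
  (∏ i, Real.smoothTransition (c i + pairing (W i) x)) * (d + pairing h x)

omit [DecidableEq V] in
lemma contDiff_cutoffFun (c : V → ℝ) (W : V → V → ℝ) (d : ℝ) (h : V → ℝ) :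
    ContDiff ℝ 1 (cutoffFun c W d h) := by
  refine ContDiff.mul (contDiff_prod fun i _ => ?_) (by fun_prop)
  exact (Real.smoothTransition.contDiff (n := 1)).comp (by fun_prop)

lemma fderiv_cutoffFun (c : V → ℝ) (W : V → V → ℝ) (d : ℝ) (h x v : V → ℝ) :
    fderiv ℝ (cutoffFun c W d h) x v =
      (∏ i, Real.smoothTransition (c i + pairing (W i) x)) * pairing h v +
      (d + pairing h x) * ∑ i, (∏ j ∈ Finset.univ.erase i,
        Real.smoothTransition (c j + pairing (W j) x)) *
          (deriv Real.smoothTransition (c i + pairing (W i) x) * pairing (W i) v) := by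
  have h1 : ∀ i ∈ (Finset.univ : Finset V),
      HasFDerivAt (fun x => Real.smoothTransition (c i + pairing (W i) x))
        (deriv Real.smoothTransition (c i + pairing (W i) x) • pairing (W i)) x := by
    intro i _
    have hd : HasDerivAt Real.smoothTransition
        (deriv Real.smoothTransition (c i + pairing (W i) x)) (c i + pairing (W i) x) :=
      ((Real.smoothTransition.contDiff (n := 1)).differentiable (by norm_num) _).hasDerivAt
    exact hd.comp_hasFDerivAt x ((pairing (W i)).hasFDerivAt.const_add (c i))
  have h2 := (HasFDerivAt.finsetProd h1).mul ((pairing h).hasFDerivAt.const_add d)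
  have h3 : fderiv ℝ (cutoffFun c W d h) x = _ := h2.fderiv
  rw [h3]
  simp [Finset.mul_sum]

lemma memD_cutoffFun {r : V → V → ℝ} {c : V → ℝ} {W : V → V → ℝ} {d : ℝ} {h : V → ℝ}
    (hyp : ∀ i, ∀ x ∈ stdSimplex ℝ V, x i = 0 → (∀ l, 0 < c l + pairing (W l) x) →
      gen r h i = 0 ∧ (∀ l, l ≠ i → gen r (W l) i = 0) ∧ 1 ≤ c i + pairing (W i) x) :
    MemD r Finset.univ (cutoffFun c W d h) := by
  refine ⟨⟨Set.univ, isOpen_univ, Set.subset_univ _, (contDiff_cutoffFun c W d h).contDiffOn⟩,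
    fun i _ x hx hxi => ?_⟩
  rw [fderiv_cutoffFun]
  by_cases hpos : ∀ l, 0 < c l + pairing (W l) x
  · obtain ⟨h1, h2, h3⟩ := hyp i x hx hxi hpos
    rw [pairing_apply h, sum_mul_vvec, h1, mul_zero, zero_add, Finset.sum_eq_zero, mul_zero]
    intro l _
    by_cases hl : l = i
    · rw [hl, deriv_smoothTransition_eq_zero (Or.inr h3), zero_mul, mul_zero]
    · rw [pairing_apply (W l) (vvec r i), sum_mul_vvec, h2 l hl, mul_zero, mul_zero]
  · push Not at hpos
    obtain ⟨l, hl⟩ := hpos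
    have hz : Real.smoothTransition (c l + pairing (W l) x) = 0 :=
      Real.smoothTransition.zero_of_nonpos hl
    rw [Finset.prod_eq_zero (Finset.mem_univ l) hz, zero_mul, zero_add, Finset.sum_eq_zero,
      mul_zero]
    intro k _
    by_cases hk : k = l
    · rw [hk, deriv_smoothTransition_eq_zero (Or.inl hl), zero_mul, mul_zero]
    · rw [Finset.prod_eq_zero (Finset.mem_erase.2 ⟨Ne.symm hk, Finset.mem_univ l⟩) hz, zero_mul]

/-- Condition (A) is preserved by time shifts. -/
lemma CondA.shift {r : V → V → ℝ} {ζ : ℝ → V → ℝ} (hζ : IsPath ζ) (hA : CondA r ζ)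
    {T : ℝ} (hT : 0 ≤ T) : CondA r fun t => ζ (T + t) := by
  intro f hf t ht
  obtain ⟨U, hUo, hU, hfU⟩ := hf.1
  have hcont : ContinuousOn (fun s => fderiv ℝ f (ζ s) (lamV r)) (Set.Ici 0) :=
    ((hfU.continuousOn_fderiv_of_isOpen hUo le_rfl).comp hζ.1
      fun s hs => hU (hζ.2 s hs)).clm_apply continuousOn_const
  have hint : ∀ a b : ℝ, 0 ≤ a → 0 ≤ b →
      IntervalIntegrable (fun s => fderiv ℝ f (ζ s) (lamV r)) MeasureTheory.volume a b :=
    fun a b ha hb => (hcont.mono fun s hs =>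
      (le_min ha hb).trans hs.1).intervalIntegrable
  have h1 := hA f hf (T + t) (by linarith)
  have h2 := hA f hf T hT
  rw [← intervalIntegral.integral_add_adjacent_intervals (hint 0 T le_rfl hT)
    (hint T (T + t) hT (by linarith))] at h1
  have h3 := intervalIntegral.integral_comp_add_left (a := 0) (b := t)
    (fun s => fderiv ℝ f (ζ s) (lamV r)) T
  simp only [add_zero] at h3 ⊢
  rw [h3]
  linarith

omit [DecidableEq V] in
lemma IsPath.shift {ζ : ℝ → V → ℝ} (hζ : IsPath ζ) {T : ℝ} (hT : 0 ≤ T) :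
    IsPath fun t => ζ (T + t) :=
  ⟨hζ.1.comp (by fun_prop) fun t (ht : 0 ≤ t) => add_nonneg hT ht,
    fun t ht => hζ.2 _ (add_nonneg hT ht)⟩

omit [DecidableEq V] in
lemma mem_suppF {u : V → ℝ} {i : V} : i ∈ suppF u ↔ 0 < u i := by
  classical
  simp [suppF]

omit [DecidableEq V] in
lemma suppF_nonempty {u : V → ℝ} (hu : u ∈ stdSimplex ℝ V) : (suppF u).Nonempty := by
  by_contra h
  rw [Finset.not_nonempty_iff_eq_empty] at h
  have : ∀ i, u i = 0 := fun i => le_antisymm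
    (not_lt.1 fun hi => by simpa [h] using mem_suppF.2 hi) (hu.1 i)
  have h1 := hu.2
  simp [this] at h1

omit [DecidableEq V] in
lemma eq_zero_of_notMem_suppF {u : V → ℝ} (hu : u ∈ stdSimplex ℝ V) {i : V}
    (hi : i ∉ suppF u) : u i = 0 :=
  le_antisymm (not_lt.1 fun h => hi (mem_suppF.2 h)) (hu.1 i)

/-- The vector `λ^A` extended by zero off `A`. -/
noncomputable def drift (r : V → V → ℝ) (ind : Finset V → V → V → ℝ) (A : Finset V) (i : V) : ℝ :=
  if i ∈ A then lamA r ind A i else 0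

section Flow

variable {r : V → V → ℝ} {ind : Finset V → V → V → ℝ}

/-- The additive constants of the cutoffs used near the face of `A`. -/
noncomputable def cutConst (r G : V → V → ℝ) (A : Finset V) (i : V) : ℝ :=
  if i ∈ A then -1 else (∑ l, r i l) * ∑ x, G i x

/-- The linear parts of the cutoffs used near the face of `A`. -/
noncomputable def cutLin (r : V → V → ℝ) (ind : Finset V → V → V → ℝ) (G : V → V → ℝ)
    (A : Finset V) (a N : ℝ) (i x : V) : ℝ :=
  if i ∈ A then a⁻¹ * ind A i x else -((∑ l, r i l) * N) * G i x

lemma cut_apply_of_mem {G : V → V → ℝ} {A : Finset V} {a N : ℝ} {i : V} (hi : i ∈ A)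
    (x : V → ℝ) :
    cutConst r G A i + pairing (cutLin r ind G A a N i) x = a⁻¹ * pairing (ind A i) x - 1 := by
  simp only [cutConst, cutLin, pairing_apply, if_pos hi, mul_assoc, ← Finset.mul_sum]
  ring

lemma pairing_cutLin_of_notMem {G : V → V → ℝ} {A : Finset V} {a N : ℝ} {i : V} (hi : i ∉ A)
    (x : V → ℝ) :
    pairing (cutLin r ind G A a N i) x = -((∑ l, r i l) * N) * pairing (G i) x := by
  simp only [cutLin, pairing_apply, if_neg hi, mul_assoc, ← Finset.mul_sum]

lemma cut_apply_of_notMem {G : V → V → ℝ} {A : Finset V} {a N : ℝ} {i : V} (hi : i ∉ A)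
    (x : V → ℝ) :
    cutConst r G A i + pairing (cutLin r ind G A a N i) x =
      (∑ l, r i l) * (∑ x, G i x - N * pairing (G i) x) := by
  rw [pairing_cutLin_of_notMem hi, cutConst, if_neg hi]
  ring

lemma gen_cutLin_of_notMem (hind : IsHarmFamily r ind) {G : V → V → ℝ} {A : Finset V}
    {a N : ℝ} {i l : V} (hi : i ∉ A) (hl : l ≠ i)
    (hG : ∀ k ∉ A, ∀ i ∉ A, gen r (G k) i = if i = k then -1 else 0) :
    gen r (cutLin r ind G A a N l) i = 0 := by
  by_cases hlA : l ∈ A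
  · have : cutLin r ind G A a N l = fun x => a⁻¹ * ind A l x := by
      funext x; simp [cutLin, hlA]
    rw [this, gen_smul, gen_ind hind hlA hi, mul_zero]
  · have : cutLin r ind G A a N l = fun x => -((∑ j, r l j) * N) * G l x := by
      funext x; simp only [cutLin, if_neg hlA]
    rw [this, gen_smul, hG l hlA i hi, if_neg (Ne.symm hl), mul_zero]

variable (hr : ∀ i j, 0 ≤ r i j) (hirr : IrreducibleRates r) (hind : IsHarmFamily r ind)
include hr hirr hind

/-- Test functions in `D_V` that localize near the relative interior of the face of `A`. -/
lemma exists_memD_cutoffFun {A : Finset V} (hA : A.Nonempty) {a : ℝ} (ha : 0 < a) :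
    ∃ G : V → V → ℝ, ∃ N₀ : ℝ,
      (∀ k ∉ A, ∀ x, 0 ≤ G k x) ∧ (∀ k ∉ A, 0 < G k k) ∧ (∀ k ∉ A, 0 < ∑ l, r k l) ∧
      (∀ k ∉ A, 1 ≤ cutConst r G A k) ∧ (∀ k ∉ A, ∀ x ∈ A, G k x = 0) ∧
      (∀ k ∉ A, ∀ i ∉ A, i ≠ k → gen r (G k) i = 0) ∧
      ∀ N > N₀, 0 < N → ∀ d h, (∀ i ∉ A, gen r h i = 0) →
        MemD r Finset.univ (cutoffFun (cutConst r G A) (cutLin r ind G A a N) d h) := by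
  obtain ⟨G, hG1, hG2, hG3⟩ := exists_green hr hirr hA
  have hG0 : ∀ k ∉ A, ∀ x, 0 ≤ G k x := fun k hk =>
    nonneg_of_superharmonic hr hirr hA (fun x hx => (hG1 k hk x hx).ge) fun i hi => by
      rw [hG2 k hk i hi]; split_ifs <;> norm_num
  have hR0 : ∀ k, 0 ≤ ∑ l, r k l := fun k => Finset.sum_nonneg fun l _ => hr k l
  have hRG : ∀ k ∉ A, 0 < (∑ l, r k l) * G k k := fun k hk => by
    rw [hG3 k hk k, if_pos rfl]
    have : 0 ≤ ∑ l ∈ Aᶜ, r l k * G l k := Finset.sum_nonneg fun l hl =>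
      mul_nonneg (hr _ _) (hG0 l (Finset.mem_compl.1 hl) k)
    linarith
  have hGpos : ∀ k ∉ A, 0 < G k k := fun k hk => pos_of_mul_pos_right (hRG k hk) (hR0 k)
  have hR : ∀ k ∉ A, 0 < ∑ l, r k l := fun k hk => pos_of_mul_pos_left (hRG k hk) (hG0 k hk k)
  have hm0 : ∀ k ∉ A, 0 ≤ ∑ x, G k x := fun k hk => Finset.sum_nonneg fun x _ => hG0 k hk x
  have hm : ∀ k ∉ A, (∑ l, r k l) * ∑ x, G k x = ∑ l ∈ Aᶜ, r l k * ∑ x, G l x + 1 := by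
    intro k hk
    rw [Finset.mul_sum, Finset.sum_congr rfl fun x _ => hG3 k hk x, Finset.sum_add_distrib,
      Finset.sum_comm]
    simp [Finset.mul_sum]
  have hpair : ∀ k ∉ A, ∀ x : V → ℝ, (∑ l, r k l) * pairing (G k) x =
      ∑ l ∈ Aᶜ, r l k * pairing (G l) x + x k := by
    intro k hk x
    simp only [pairing_apply, Finset.mul_sum]
    rw [Finset.sum_comm, Finset.sum_congr rfl fun y _ => show _ =
      (∑ l ∈ Aᶜ, r l k * (G l y * x y)) + if y = k then x y else 0 by
        rw [← mul_assoc, hG3 k hk y, add_mul, Finset.sum_mul, ite_mul, one_mul, zero_mul]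
        simp only [mul_assoc], Finset.sum_add_distrib]
    simp
  refine ⟨G, (∑ l ∈ Aᶜ, (∑ x, G l x) / G l l) / a, hG0, hGpos, hR, fun k hk => ?_, hG1,
    fun k hk i hi hik => by rw [hG2 k hk i hi, if_neg hik], ?_⟩
  · rw [cutConst, if_neg hk, hm k hk]
    have : 0 ≤ ∑ l ∈ Aᶜ, r l k * ∑ x, G l x := Finset.sum_nonneg fun l hl =>
      mul_nonneg (hr _ _) (hm0 l (Finset.mem_compl.1 hl))
    linarith
  · intro N hN hN0 d h hh
    refine memD_cutoffFun fun i x hx hxi hpos => ?_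
    have hlt : ∀ l ∉ A, N * pairing (G l) x < ∑ y, G l y := by
      intro l hl
      have := hpos l
      rw [cut_apply_of_notMem hl] at this
      linarith [pos_of_mul_pos_right this (hR0 l)]
    have hiA : i ∉ A := by
      intro hiA
      have hi := hpos i
      rw [cut_apply_of_mem hiA] at hi
      have hq : pairing (ind A i) x ≤ (∑ l ∈ Aᶜ, (∑ x, G l x) / G l l) / N := by
        rw [pairing_apply, ← Finset.sum_add_sum_compl A, Finset.sum_eq_zero (s := A), zero_add,
          Finset.sum_div]
        · refine Finset.sum_le_sum fun l hl => ?_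
          rw [Finset.mem_compl] at hl
          have hGl := hGpos l hl
          have h1 : G l l * x l ≤ pairing (G l) x := by
            rw [pairing_apply]
            exact Finset.single_le_sum (f := fun y => G l y * x y)
              (fun y _ => mul_nonneg (hG0 l hl y) (hx.1 y)) (Finset.mem_univ l)
          have h2 : x l ≤ (∑ y, G l y) / G l l / N := by
            rw [le_div_iff₀ hN0, le_div_iff₀ hGl]
            nlinarith [hlt l hl]
          exact (mul_le_of_le_one_left (hx.1 l) (ind_le_one hr hirr hind hiA l)).trans h2
        · intro l hl
          rw [ind_on hind hiA hl]
          split_ifs with hli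
          · rw [hli, hxi, mul_zero]
          · rw [zero_mul]
      have hle : (∑ l ∈ Aᶜ, (∑ x, G l x) / G l l) / N < a := by
        rw [div_lt_iff₀ hN0]
        rw [gt_iff_lt, div_lt_iff₀ ha] at hN
        linarith
      have : a⁻¹ * pairing (ind A i) x < 1 := by
        rw [inv_mul_lt_iff₀ ha]
        linarith
      linarith
    refine ⟨hh i hiA, fun l hl => gen_cutLin_of_notMem hind hiA hl hG2, ?_⟩
    rw [cut_apply_of_notMem hiA, mul_sub, hm i hiA]
    have h1 := hpair i hiA x
    rw [hxi, add_zero] at h1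
    have h2 : ∑ l ∈ Aᶜ, r l i * (N * pairing (G l) x) ≤ ∑ l ∈ Aᶜ, r l i * ∑ y, G l y :=
      Finset.sum_le_sum fun l hl =>
        mul_le_mul_of_nonneg_left (hlt l (Finset.mem_compl.1 hl)).le (hr _ _)
    have h3 : (∑ l, r i l) * (N * pairing (G i) x) =
        ∑ l ∈ Aᶜ, r l i * (N * pairing (G l) x) := by
      rw [mul_left_comm, h1, Finset.mul_sum]
      exact Finset.sum_congr rfl fun l _ => by ring
    linarith

/-- A path started from a configuration with absorbing support `A` moves with
velocity `λ^A` for a short time. -/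
lemma exists_forall_eq_drift {u : V → ℝ} (hu : u ∈ SigmaAbs r ind) {ζ : ℝ → V → ℝ}
    (hζ : IsPath ζ) (hζA : CondA r ζ) (h0 : ζ 0 = u) :
    ∃ ε > 0, ∀ t ∈ Set.Icc (0 : ℝ) ε, ∀ i, ζ t i = u i + t * drift r ind (suppF u) i := by
  obtain ⟨hus, habs⟩ := hu
  set A := suppF u
  have hAne : A.Nonempty := suppF_nonempty hus
  have hA' : ∀ j ∉ A, lamA r ind (insert j A) j ≤ 0 := by
    rcases habs with h | h
    · intro j hj; simp [h] at hj
    · exact h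
  have hu0 : ∀ i ∉ A, u i = 0 := fun i hi => eq_zero_of_notMem_suppF hus hi
  obtain ⟨a, ha, hau⟩ : ∃ a > 0, ∀ i ∈ A, 2 * a < u i := by
    obtain ⟨i, hi, hmin⟩ := Finset.exists_min_image A u hAne
    have := mem_suppF.1 hi
    exact ⟨u i / 3, by linarith, fun j hj => by linarith [hmin j hj]⟩
  have hpair_face : ∀ x : V → ℝ, (∀ k ∉ A, x k = 0) → ∀ i ∈ A, pairing (ind A i) x = x i := by
    intro x hx i hi
    rw [pairing_apply, Finset.sum_eq_single_of_mem i (Finset.mem_univ i)]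
    · simp [ind_on hind hi hi]
    · intro k _ hki
      by_cases hk : k ∈ A
      · simp [ind_on hind hi hk, hki]
      · simp [hx k hk]
  obtain ⟨ε, hε, hεq⟩ : ∃ ε > 0, ∀ t ∈ Set.Icc (0 : ℝ) ε, ∀ i ∈ A,
      2 * a < pairing (ind A i) (ζ t) := by
    have hev : ∀ᶠ t in nhdsWithin (0 : ℝ) (Set.Ici 0), ∀ i ∈ A,
        2 * a < pairing (ind A i) (ζ t) := by
      rw [Filter.eventually_all_finset]
      intro i hi
      have hc : ContinuousWithinAt (fun t => pairing (ind A i) (ζ t)) (Set.Ici 0) 0 :=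
        (pairing (ind A i)).continuous.continuousAt.comp_continuousWithinAt
          (hζ.1 0 Set.self_mem_Ici)
      refine hc.eventually (lt_mem_nhds ?_)
      simp only [h0, hpair_face u hu0 i hi]
      exact hau i hi
    obtain ⟨ε, hε, hsub⟩ := (mem_nhdsGE_iff_exists_Icc_subset).1 hev
    exact ⟨ε, hε, fun t ht => hsub ht⟩
  obtain ⟨G, N₀, hG0, hGpos, hR, hc1, hGA, hGh, hmem⟩ :=
    exists_memD_cutoffFun hr hirr hind hAne ha
  have hPA : ∀ N, ∀ t ∈ Set.Icc (0 : ℝ) ε, ∀ i ∈ A,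
      1 ≤ cutConst r G A i + pairing (cutLin r ind G A a N i) (ζ t) := by
    intro N t ht i hi
    rw [cut_apply_of_mem hi]
    have : 2 ≤ a⁻¹ * pairing (ind A i) (ζ t) := by
      rw [le_inv_mul_iff₀ ha]
      linarith [hεq t ht i hi]
    linarith
  have hP0 : ∀ N, ∀ x : V → ℝ, (∀ k ∉ A, x k = 0) → ∀ i ∉ A,
      1 ≤ cutConst r G A i + pairing (cutLin r ind G A a N i) x := by
    intro N x hx i hi
    have : pairing (G i) x = 0 := by
      rw [pairing_apply]
      refine Finset.sum_eq_zero fun y _ => ?_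
      by_cases hy : y ∈ A
      · rw [hGA i hi y hy, zero_mul]
      · rw [hx y hy, mul_zero]
    rw [pairing_cutLin_of_notMem hi, this, mul_zero, add_zero]
    exact hc1 i hi
  have hGlam : ∀ k ∉ A, pairing (G k) (lamV r) ≤ 0 := by
    intro k hk
    rw [pairing_apply, sum_mul_lamV_eq hr hirr hind (Finset.insert_nonempty k A)
      (fun i hi => hGh k hk i (fun h => hi (Finset.mem_insert_of_mem h))
        (fun h => hi (h ▸ Finset.mem_insert_self _ _))), Finset.sum_insert hk,
      Finset.sum_eq_zero fun x hx => by rw [hGA k hk x hx, zero_mul], add_zero]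
    exact mul_nonpos_of_nonneg_of_nonpos (hGpos k hk).le (hA' k hk)
  have hone : ∀ N, ∀ t ∈ Set.Icc (0 : ℝ) ε, (∀ k ∉ A, ζ t k = 0) → ∀ i,
      1 ≤ cutConst r G A i + pairing (cutLin r ind G A a N i) (ζ t) := fun N t ht hx i => by
    by_cases hi : i ∈ A
    · exact hPA N t ht i hi
    · exact hP0 N _ hx i hi
  have h0mem : (0 : ℝ) ∈ Set.Icc 0 ε := ⟨le_rfl, hε.le⟩
  have hface0 : ∀ k ∉ A, ζ 0 k = 0 := by rw [h0]; exact hu0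
  have hlt : ∀ N > N₀, 0 < N → ∀ t ∈ Set.Icc (0 : ℝ) ε, ∀ k ∉ A,
      N * pairing (G k) (ζ t) < ∑ x, G k x := by
    intro N hN hN0 t ht k hk
    have hflow := hζA _ (hmem N hN hN0 1 0 fun i _ => by simp [gen]) t ht.1
    have hstart : cutoffFun (cutConst r G A) (cutLin r ind G A a N) 1 0 (ζ 0) = 1 := by
      rw [cutoffFun, Finset.prod_eq_one fun i _ =>
        Real.smoothTransition.one_of_one_le (hone N 0 h0mem hface0 i)]
      simp [pairing_apply]
    have hint : 0 ≤ ∫ s in (0 : ℝ)..t, fderiv ℝ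
        (cutoffFun (cutConst r G A) (cutLin r ind G A a N) 1 0) (ζ s) (lamV r) := by
      refine intervalIntegral.integral_nonneg ht.1 fun s hs => ?_
      have hs' : s ∈ Set.Icc (0 : ℝ) ε := ⟨hs.1, hs.2.trans ht.2⟩
      rw [fderiv_cutoffFun]
      simp only [pairing_apply 0, Pi.zero_apply, zero_mul, Finset.sum_const_zero, mul_zero,
        zero_add, add_zero, one_mul]
      refine Finset.sum_nonneg fun i _ => mul_nonneg
        (Finset.prod_nonneg fun j _ => Real.smoothTransition.nonneg _) ?_
      by_cases hi : i ∈ A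
      · rw [deriv_smoothTransition_eq_zero (Or.inr (hPA N s hs' i hi)), zero_mul]
      · refine mul_nonneg Real.smoothTransition.monotone.deriv_nonneg ?_
        rw [pairing_cutLin_of_notMem hi]
        exact mul_nonneg_of_nonpos_of_nonpos
          (neg_nonpos.2 (mul_nonneg (hR i hi).le hN0.le)) (hGlam i hi)
    rw [hstart] at hflow
    have hne : cutoffFun (cutConst r G A) (cutLin r ind G A a N) 1 0 (ζ t) ≠ 0 := by linarith
    have hk' := Finset.prod_ne_zero_iff.1 (left_ne_zero_of_mul hne) k (Finset.mem_univ k)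
    rw [Ne, Real.smoothTransition.zero_iff_nonpos, not_le, cut_apply_of_notMem hk] at hk'
    linarith [pos_of_mul_pos_right hk' (hR k hk).le]
  have hface : ∀ t ∈ Set.Icc (0 : ℝ) ε, ∀ k ∉ A, ζ t k = 0 := by
    intro t ht k hk
    have hζt := hζ.2 t ht.1
    have hnp : pairing (G k) (ζ t) ≤ 0 := by
      by_contra! hpos
      set N := max (max (N₀ + 1) 1) ((∑ x, G k x) / pairing (G k) (ζ t))
      have h1 : N₀ + 1 ≤ N := (le_max_left _ _).trans (le_max_left _ _)
      have h2 : 1 ≤ N := (le_max_right _ _).trans (le_max_left _ _)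
      have h3 : (∑ x, G k x) / pairing (G k) (ζ t) ≤ N := le_max_right _ _
      rw [div_le_iff₀ hpos] at h3
      linarith [hlt N (by linarith) (by linarith) t ht k hk]
    have h1 : G k k * ζ t k ≤ pairing (G k) (ζ t) := by
      rw [pairing_apply]
      exact Finset.single_le_sum (f := fun y => G k y * ζ t y)
        (fun y _ => mul_nonneg (hG0 k hk y) (hζt.1 y)) (Finset.mem_univ k)
    have h2 := hζt.1 k
    have h3 := hGpos k hk
    nlinarith
  refine ⟨ε, hε, fun t ht i => ?_⟩
  by_cases hi : i ∈ A
  · obtain ⟨N, hN, hN0⟩ : ∃ N, N₀ < N ∧ 0 < N :=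
      ⟨max N₀ 0 + 1, by linarith [le_max_left N₀ 0], by linarith [le_max_right N₀ 0]⟩
    have hval : ∀ s ∈ Set.Icc (0 : ℝ) ε,
        cutoffFun (cutConst r G A) (cutLin r ind G A a N) 0 (ind A i) (ζ s) = ζ s i := by
      intro s hs
      rw [cutoffFun, Finset.prod_eq_one fun j _ =>
        Real.smoothTransition.one_of_one_le (hone N s hs (hface s hs) j),
        hpair_face _ (hface s hs) i hi]
      ring
    have hflow := hζA _ (hmem N hN hN0 0 (ind A i) fun k hk => gen_ind hind hi hk) t ht.1
    rw [hval t ht, hval 0 h0mem, h0, intervalIntegral.integral_congr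
      (g := fun _ => lamA r ind A i), intervalIntegral.integral_const] at hflow
    · simpa [drift, hi] using hflow
    · intro s hs
      rw [Set.uIcc_of_le ht.1] at hs
      have hs' : s ∈ Set.Icc (0 : ℝ) ε := ⟨hs.1, hs.2.trans ht.2⟩
      have hP := hone N s hs' (hface s hs')
      simp only
      rw [fderiv_cutoffFun, Finset.prod_eq_one fun j _ =>
        Real.smoothTransition.one_of_one_le (hP j), Finset.sum_eq_zero fun j _ => by
          rw [deriv_smoothTransition_eq_zero (Or.inr (hP j)), zero_mul, mul_zero],
        lamA_eq hr hirr hind hi, pairing_apply]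
      ring
  · simp [drift, hi, hface t ht i hi, hu0 i hi]

/-- Two paths satisfying condition (A) started from the same point of `Σ_abs` coincide. -/
lemma eq_of_condA (n : ℕ) : ∀ {u : V → ℝ}, u ∈ SigmaAbs r ind → (suppF u).card ≤ n →
    ∀ {ζ ζ' : ℝ → V → ℝ}, IsPath ζ → IsPath ζ' → CondA r ζ → CondA r ζ' →
    ζ 0 = u → ζ' 0 = u → ∀ t : ℝ, 0 ≤ t → ζ t = ζ' t := by
  induction n with
  | zero =>
    intro u hu hcard
    exact absurd (Finset.card_eq_zero.1 (Nat.le_zero.1 hcard)) (suppF_nonempty hu.1).ne_empty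
  | succ n ih =>
    intro u hu hcard ζ ζ' hζ hζ' hζA hζ'A h0 h0' t ht
    by_contra hne
    set A := suppF u with hA
    set line : ℝ → V → ℝ := fun s i => u i + s * drift r ind A i with hline
    have hline_cont : Continuous line := by
      rw [hline]; fun_prop
    let E : Set ℝ := {τ | 0 ≤ τ ∧ ∀ s ∈ Set.Icc 0 τ, ζ s = line s ∧ ζ' s = line s}
    have hE0 : (0 : ℝ) ∈ E := ⟨le_rfl, fun s hs => by
      have : s = 0 := le_antisymm hs.2 hs.1
      subst this
      rw [h0, h0']
      simp [hline]⟩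
    have hEb : BddAbove E := ⟨t, fun τ hτ => not_lt.1 fun h => hne <| by
      rw [(hτ.2 t ⟨ht, h.le⟩).1, (hτ.2 t ⟨ht, h.le⟩).2]⟩
    set T := sSup E
    have hT0 : 0 ≤ T := le_csSup hEb hE0
    have hlt : ∀ s, 0 ≤ s → s < T → ζ s = line s ∧ ζ' s = line s := by
      intro s hs hsT
      obtain ⟨τ, hτ, hsτ⟩ := exists_lt_of_lt_csSup ⟨0, hE0⟩ hsT
      exact hτ.2 s ⟨hs, hsτ.le⟩
    have hlim : ∀ {ξ : ℝ → V → ℝ}, IsPath ξ → (∀ s, 0 ≤ s → s < T → ξ s = line s) →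
        ξ 0 = line 0 → ξ T = line T := by
      intro ξ hξ hξs hξ0
      rcases hT0.eq_or_lt with h | h
      · rw [← h]; exact hξ0
      · have hsub : Set.Ico 0 T ⊆ Set.Ici (0 : ℝ) := fun s hs => hs.1
        have hTcl : T ∈ closure (Set.Ico 0 T) := by
          rw [closure_Ico h.ne]; exact ⟨h.le, le_rfl⟩
        have := mem_closure_iff_nhdsWithin_neBot.1 hTcl
        refine tendsto_nhds_unique_of_eventuallyEq ((hξ.1 T hT0).mono hsub)
          hline_cont.continuousWithinAt ?_
        filter_upwards [self_mem_nhdsWithin] with s hs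
        exact hξs s hs.1 hs.2
    have hζT := hlim hζ (fun s hs hsT => (hlt s hs hsT).1) (hE0.2 0 ⟨le_rfl, le_rfl⟩).1
    have hζ'T := hlim hζ' (fun s hs hsT => (hlt s hs hsT).2) (hE0.2 0 ⟨le_rfl, le_rfl⟩).2
    have hTE : T ∈ E := ⟨hT0, fun s hs => by
      rcases hs.2.eq_or_lt with h | h
      · rw [h]; exact ⟨hζT, hζ'T⟩
      · exact hlt s hs.1 h⟩
    have htT : T < t := lt_of_not_ge fun h => hne <| by
      rw [(hTE.2 t ⟨ht, h⟩).1, (hTE.2 t ⟨ht, h⟩).2]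
    have hlT : line T ∈ stdSimplex ℝ V := hζT ▸ hζ.2 T hT0
    have hsub : suppF (line T) ⊆ A := by
      intro i hi
      by_contra hiA
      have hpos := mem_suppF.1 hi
      simp [hline, drift, hiA, eq_zero_of_notMem_suppF hu.1 hiA] at hpos
    have habs : line T ∈ SigmaAbs r ind := by
      refine ⟨hlT, IsAbsorbing.of_neg hr hirr hind hu.2 hsub (suppF_nonempty hlT) ?_⟩
      intro i hi hi'
      have h1 := eq_zero_of_notMem_suppF hlT hi'
      have h2 : 0 < u i := mem_suppF.1 hi
      simp only [hline, drift, hA, if_pos hi] at h1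
      by_contra! h3
      nlinarith [mul_nonneg hT0 h3.le]
    rcases hsub.eq_or_ssubset with hEq | hss
    · have hext : ∀ {ξ : ℝ → V → ℝ}, IsPath ξ → CondA r ξ → ξ T = line T →
          ∃ ε > 0, ∀ s ∈ Set.Icc (0 : ℝ) ε, ξ (T + s) = line (T + s) := by
        intro ξ hξ hξA hξT
        obtain ⟨ε, hε, h⟩ := exists_forall_eq_drift hr hirr hind habs (hξ.shift hT0)
          (hξA.shift hξ hT0) (by simpa using hξT)
        refine ⟨ε, hε, fun s hs => funext fun i => ?_⟩
        have := h s hs i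
        rw [hEq] at this
        simp only [this, hline]
        ring
      obtain ⟨ε, hε, h⟩ := hext hζ hζA hζT
      obtain ⟨ε', hε', h'⟩ := hext hζ' hζ'A hζ'T
      have hmem : T + min ε ε' ∈ E := by
        refine ⟨by positivity, fun s hs => ?_⟩
        rcases le_total s T with hsT | hsT
        · exact hTE.2 s ⟨hs.1, hsT⟩
        · have h1 := h (s - T) ⟨by linarith, by linarith [hs.2, min_le_left ε ε']⟩
          have h2 := h' (s - T) ⟨by linarith, by linarith [hs.2, min_le_right ε ε']⟩
          rw [add_sub_cancel] at h1 h2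
          exact ⟨h1, h2⟩
      have := le_csSup hEb hmem
      linarith [lt_min hε hε']
    · have hcard' : (suppF (line T)).card ≤ n := by
        have := Finset.card_lt_card hss
        omega
      have := ih habs hcard' (hζ.shift hT0) (hζ'.shift hT0) (hζA.shift hζ hT0)
        (hζ'A.shift hζ' hT0) (by simpa using hζT) (by simpa using hζ'T) (t - T) (by linarith)
      simp only [add_sub_cancel] at this
      exact hne this

end Flow

end Aux

/-- uniqueness of continuous paths satisfying condition (A) started at a
configuration of `Σ_abs`. -/
theorem uniqueness_from_absorbing_start (V : Type*) [Fintype V] [DecidableEq V] [Nonempty V]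
    (r : V → V → ℝ) (hr_nonneg : ∀ i j, 0 ≤ r i j) (hr_diag : ∀ i, r i i = 0)
    (hr_irr : IrreducibleRates r)
    (ind : Finset V → V → V → ℝ) (hind : IsHarmFamily r ind)
    (u : V → ℝ) (hu : u ∈ SigmaAbs r ind)
    (ζ ζ' : ℝ → V → ℝ) (hζ : IsPath ζ) (hζ' : IsPath ζ')
    (hζA : CondA r ζ) (hζ'A : CondA r ζ')
    (h0 : ζ 0 = u) (h0' : ζ' 0 = u) :
    ∀ t : ℝ, 0 ≤ t → ζ t = ζ' t := by
  exact eq_of_condA hr_nonneg hr_irr hind _ hu le_rfl hζ hζ' hζA hζ'A h0 h0'
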